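/- Fix a real ℓ ≥ 1 and ε > 0. Then there exists a scoring rule f : (0,1) → ℝ that is the restriction of a polynomial, is a normalized proper scoring rule, has strongly convex reward function (i.e., there exists a constant a > 0 with (R^f)″(x) ≥ a for all x ∈ (0,1)), and satisfies Ind^ℓ(f) ≤ Ind^ℓ(g_{ℓ,Opt}) + ε, where g_{ℓ,Opt} is the optimal scoring rule for exponent ℓ. -/

import Mathlib

open MeasureTheory Set

noncomputable def rewardFn (f : ℝ → ℝ) : ℝ → ℝ := fun x => x * f x + (1 - x) * f (1 - x)

/-- `f` is a (strictly) proper scoring rule: for every belief `p ∈ (0,1)`,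
the expected reward `x ↦ p·f(x) + (1−p)·f(1−x)` is strictly maximized over `(0,1)` at `x = p`. -/
def IsProperRule (f : ℝ → ℝ) : Prop :=
  ∀ p ∈ Set.Ioo (0:ℝ) 1, ∀ x ∈ Set.Ioo (0:ℝ) 1, x ≠ p →
    p * f x + (1 - p) * f (1 - x) < p * f p + (1 - p) * f (1 - p)

/-- `f` is a weakly proper scoring rule: for every belief `p ∈ (0,1)`,
the expected reward `x ↦ p·f(x) + (1−p)·f(1−x)` is (weakly) maximized over `(0,1)` at `x = p`. -/
def IsWeaklyProperRule (f : ℝ → ℝ) : Prop :=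
  ∀ p ∈ Set.Ioo (0:ℝ) 1, ∀ x ∈ Set.Ioo (0:ℝ) 1,
    p * f x + (1 - p) * f (1 - x) ≤ p * f p + (1 - p) * f (1 - p)
open scoped ENNReal

/-- A scoring rule `g` is normalized if `g(1/2) = 0` and `∫₀¹ R^g(x) dx = 1`. -/
noncomputable def IsNormalizedRule (g : ℝ → ℝ) : Prop :=
  g (1/2) = 0 ∧ (∫ x in (0:ℝ)..1, rewardFn g x) = 1

/-- The incentivization index `Ind^ℓ(g) = ∫₀¹ (x(1−x)/(R^g)″(x))^{ℓ/4} dx`, valued in `[0,∞]`,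
using `(R^g)″(x) = g′(x) + g′(1−x)` for continuously differentiable proper scoring rules. -/
noncomputable def Ind (ℓ : ℝ) (g : ℝ → ℝ) : ℝ≥0∞ :=
  ∫⁻ x in Set.Ioo (0:ℝ) 1,
    (ENNReal.ofReal (x * (1 - x)) / ENNReal.ofReal (deriv g x + deriv g (1 - x))) ^ (ℓ / 4)

/-- The normalization constant `κ_ℓ`. -/
noncomputable def kappa (ℓ : ℝ) : ℝ :=
  (∫ x in Set.Ico (1/2 : ℝ) 1, (x * (1 - x) ^ (3:ℕ)) ^ (ℓ / (ℓ + 4)))⁻¹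

/-- The optimal scoring rule `g_{ℓ,Opt}`. -/
noncomputable def gOpt (ℓ : ℝ) : ℝ → ℝ := fun x =>
  if x ≤ 1/2 then
    kappa ℓ * ∫ t in (1/2:ℝ)..x, (t ^ (ℓ - 8) * (1 - t) ^ (2 * ℓ + 4)) ^ (1 / (ℓ + 4))
  else
    kappa ℓ * ∫ t in (1/2:ℝ)..x, (t ^ ℓ * (1 - t) ^ (2 * ℓ - 4)) ^ (1 / (ℓ + 4))

theorem exists_derivative_eq (Q : Polynomial ℝ) : ∃ P : Polynomial ℝ, P.derivative = Q := by
  induction Q using Polynomial.induction_on' with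
  | add p q hp hq =>
    obtain ⟨P, rfl⟩ := hp
    obtain ⟨P', rfl⟩ := hq
    exact ⟨P + P', Polynomial.derivative_add⟩
  | monomial n a =>
    refine ⟨Polynomial.monomial (n + 1) (a / (n + 1)), ?_⟩
    rw [Polynomial.derivative_monomial]
    have : (n : ℝ) + 1 ≠ 0 := by positivity
    push_cast
    rw [div_mul_cancel₀ _ this]

/-- A rule with derivative `(1 - X) * w` has reward function with second derivative `w`. -/
theorem exists_rule_of_density (w : Polynomial ℝ) :
    ∃ P : Polynomial ℝ, P.eval (1 / 2) = 0 ∧ P.derivative = (1 - Polynomial.X) * w := by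
  obtain ⟨P, hP⟩ := exists_derivative_eq ((1 - Polynomial.X) * w)
  exact ⟨P - Polynomial.C (P.eval (1 / 2)), by simp, by simp [hP]⟩



theorem hasDerivAt_rule {w P : Polynomial ℝ}
    (hP : P.derivative = (1 - Polynomial.X) * w) (x : ℝ) :
    HasDerivAt (fun y => P.eval y) ((1 - x) * w.eval x) x := by
  simpa [hP] using P.hasDerivAt x

theorem hasDerivAt_rule_reflect {w P : Polynomial ℝ} (hw : ∀ x, w.eval (1 - x) = w.eval x)
    (hP : P.derivative = (1 - Polynomial.X) * w) (x : ℝ) :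
    HasDerivAt (fun y => P.eval (1 - y)) (-(x * w.eval x)) x := by
  refine ((hasDerivAt_rule hP (1 - x)).comp x ((hasDerivAt_id x).const_sub 1)).congr_deriv ?_
  rw [hw]
  ring

theorem deriv_rule_add {w P : Polynomial ℝ} (hw : ∀ x, w.eval (1 - x) = w.eval x)
    (hP : P.derivative = (1 - Polynomial.X) * w) (x : ℝ) :
    deriv (fun y => P.eval y) x + deriv (fun y => P.eval y) (1 - x) = w.eval x := by
  rw [(hasDerivAt_rule hP x).deriv, (hasDerivAt_rule hP (1 - x)).deriv, hw]
  ring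

theorem isProperRule_of_density {w P : Polynomial ℝ} (hw : ∀ x, w.eval (1 - x) = w.eval x)
    (hP : P.derivative = (1 - Polynomial.X) * w)
    (hpos : ∀ x ∈ Ioo (0 : ℝ) 1, 0 < w.eval x) : IsProperRule fun x => P.eval x := by
  intro p hp x hx hne
  have hd : ∀ y, HasDerivAt (fun y => p * P.eval y + (1 - p) * P.eval (1 - y))
      ((p - y) * w.eval y) y := fun y =>
    (((hasDerivAt_rule hP y).const_mul p).add
      ((hasDerivAt_rule_reflect hw hP y).const_mul (1 - p))).congr_deriv (by ring)
  have hc : ∀ s, ContinuousOn (fun y => p * P.eval y + (1 - p) * P.eval (1 - y)) s :=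
    fun s y _ => (hd y).continuousAt.continuousWithinAt
  rcases lt_or_gt_of_ne hne with h | h
  · obtain ⟨c, hcm, hceq⟩ := exists_hasDerivAt_eq_slope _ _ h (hc _) fun y _ => hd y
    have hw' := hpos c ⟨hx.1.trans hcm.1, hcm.2.trans hp.2⟩
    have h1 : 0 < (p - c) * w.eval c := mul_pos (sub_pos.2 hcm.2) hw'
    rw [hceq, div_pos_iff_of_pos_right (sub_pos.2 h)] at h1
    exact sub_pos.1 h1
  · obtain ⟨c, hcm, hceq⟩ := exists_hasDerivAt_eq_slope _ _ h (hc _) fun y _ => hd y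
    have hw' := hpos c ⟨hp.1.trans hcm.1, hcm.2.trans hx.2⟩
    have h1 : (p - c) * w.eval c < 0 := mul_neg_of_neg_of_pos (sub_neg.2 hcm.1) hw'
    rw [hceq, div_lt_iff₀ (sub_pos.2 h), zero_mul] at h1
    exact sub_neg.1 h1

theorem integral_rewardFn_rule {w P : Polynomial ℝ} (hw : ∀ x, w.eval (1 - x) = w.eval x)
    (hP : P.derivative = (1 - Polynomial.X) * w) (h0 : P.eval (1 / 2) = 0) :
    ∫ x in (0 : ℝ)..1, rewardFn (fun y => P.eval y) x =
      ∫ x in (1 / 2 : ℝ)..1, (1 - x) ^ 2 * w.eval x := by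
  set R : ℝ → ℝ := rewardFn (fun y => P.eval y) with hR
  have hRc : Continuous R := by unfold R rewardFn; fun_prop
  have hRd : ∀ x, HasDerivAt R (P.eval x - P.eval (1 - x)) x := fun x =>
    (((hasDerivAt_id x).mul (hasDerivAt_rule hP x)).add
      (((hasDerivAt_id x).const_sub 1).mul (hasDerivAt_rule_reflect hw hP x))).congr_deriv
        (by simp only [id]; ring)
  have hRd' : ∀ x, HasDerivAt (fun y => P.eval y - P.eval (1 - y)) (w.eval x) x := fun x =>
    ((hasDerivAt_rule hP x).sub (hasDerivAt_rule_reflect hw hP x)).congr_deriv (by ring)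
  have hΦ : ∀ x, HasDerivAt
      (fun y => 2 * (1 - y) * R y + (1 - y) ^ 2 * (P.eval y - P.eval (1 - y)))
      ((1 - x) ^ 2 * w.eval x - 2 * R x) x := fun x => by
    have h1 := (hasDerivAt_id x).const_sub 1
    refine (((h1.const_mul 2).mul (hRd x)).add ((h1.pow 2).mul (hRd' x))).congr_deriv ?_
    simp only [id, Pi.pow_apply]
    ring
  have hint := intervalIntegral.integral_eq_sub_of_hasDerivAt (a := 1 / 2) (b := 1)
    (fun x _ => hΦ x) (Continuous.intervalIntegrable (by fun_prop) _ _)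
  have hR2 : R (1 / 2) = 0 := by
    have : (1 - 1 / 2 : ℝ) = 1 / 2 := by norm_num
    simp only [hR, rewardFn, this, h0]
    simp
  rw [hR2, intervalIntegral.integral_sub (Continuous.intervalIntegrable (by fun_prop) _ _)
    (Continuous.intervalIntegrable (by fun_prop) _ _),
    intervalIntegral.integral_const_mul] at hint
  have hsymm : ∫ x in (0 : ℝ)..(1 / 2), R x = ∫ x in (1 / 2 : ℝ)..1, R x := by
    have h := intervalIntegral.integral_comp_sub_left (a := 0) (b := 1 / 2) R 1
    rw [show (1 - 1 / 2 : ℝ) = 1 / 2 by norm_num, sub_zero] at h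
    rw [← h]
    congr 1 with x
    simp only [hR, rewardFn, sub_sub_cancel]
    ring
  rw [← intervalIntegral.integral_add_adjacent_intervals (b := 1 / 2)
    (hRc.intervalIntegrable _ _) (hRc.intervalIntegrable _ _), hsymm]
  have h3 : P.eval (1 / 2) - P.eval (1 - 1 / 2 : ℝ) = 0 := by norm_num
  rw [h3] at hint
  linarith


/-- The second derivative of the reward function of `gOpt ℓ`, up to the value at `1/2`. -/
noncomputable def optDensity (ℓ x : ℝ) : ℝ :=
  kappa ℓ * max x (1 - x) ^ (ℓ / (ℓ + 4)) * min x (1 - x) ^ ((ℓ - 8) / (ℓ + 4))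

theorem continuous_kappa_integrand {ℓ : ℝ} (hℓ : 0 ≤ ℓ) :
    Continuous fun x : ℝ => (x * (1 - x) ^ (3 : ℕ)) ^ (ℓ / (ℓ + 4)) :=
  Continuous.rpow_const (by fun_prop) fun _ => Or.inr (by positivity)

theorem kappa_eq (ℓ : ℝ) :
    kappa ℓ = (∫ x in (1 / 2 : ℝ)..1, (x * (1 - x) ^ (3 : ℕ)) ^ (ℓ / (ℓ + 4)))⁻¹ := by
  rw [kappa, intervalIntegral.integral_of_le (by norm_num), integral_Ico_eq_integral_Ioo,
    integral_Ioc_eq_integral_Ioo]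

theorem kappa_integral_pos {ℓ : ℝ} (hℓ : 0 ≤ ℓ) :
    0 < ∫ x in (1 / 2 : ℝ)..1, (x * (1 - x) ^ (3 : ℕ)) ^ (ℓ / (ℓ + 4)) := by
  refine intervalIntegral.intervalIntegral_pos_of_pos_on
    ((continuous_kappa_integrand hℓ).intervalIntegrable _ _) (fun x hx => ?_) (by norm_num)
  have h0 : 0 < x := by linarith [hx.1]
  have h1 : 0 < 1 - x := by linarith [hx.2]
  positivity

theorem kappa_pos {ℓ : ℝ} (hℓ : 0 ≤ ℓ) : 0 < kappa ℓ := by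
  rw [kappa_eq]
  exact inv_pos.2 (kappa_integral_pos hℓ)

theorem optDensity_pos {ℓ x : ℝ} (hℓ : 0 ≤ ℓ) (hx : x ∈ Ioo (0 : ℝ) 1) : 0 < optDensity ℓ x := by
  have h1 : 0 < 1 - x := sub_pos.2 hx.2
  have := kappa_pos hℓ
  have hmax : 0 < max x (1 - x) := lt_max_of_lt_left hx.1
  have hmin : 0 < min x (1 - x) := lt_min hx.1 h1
  unfold optDensity
  positivity

theorem optDensity_one_sub (ℓ x : ℝ) : optDensity ℓ (1 - x) = optDensity ℓ x := by
  simp only [optDensity, sub_sub_cancel, max_comm (1 - x), min_comm (1 - x)]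

theorem hasDerivAt_gOpt_of_gt {ℓ x : ℝ} (hx : 1 / 2 < x) (hx1 : x < 1) :
    HasDerivAt (gOpt ℓ) (kappa ℓ * (x ^ ℓ * (1 - x) ^ (2 * ℓ - 4)) ^ (1 / (ℓ + 4))) x := by
  have hcont : ∀ t ∈ Ioo (0 : ℝ) 1, ContinuousAt
      (fun t : ℝ => (t ^ ℓ * (1 - t) ^ (2 * ℓ - 4)) ^ (1 / (ℓ + 4))) t := fun t ht => by
    have h0 : t ≠ 0 := ht.1.ne'
    have h1 : 1 - t ≠ 0 := (sub_pos.2 ht.2).ne'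
    have h2 : t ^ ℓ * (1 - t) ^ (2 * ℓ - 4) ≠ 0 :=
      (mul_pos (Real.rpow_pos_of_pos ht.1 _) (Real.rpow_pos_of_pos (sub_pos.2 ht.2) _)).ne'
    exact ((continuousAt_id.rpow_const (Or.inl h0)).mul
      ((continuousAt_const.sub continuousAt_id).rpow_const (Or.inl h1))).rpow_const (Or.inl h2)
  have hd := (intervalIntegral.integral_hasDerivAt_right (a := 1 / 2) (b := x)
    (ContinuousOn.intervalIntegrable fun t ht => by
      rw [uIcc_of_le hx.le] at ht
      exact (hcont t ⟨by linarith [ht.1], by linarith [ht.2]⟩).continuousWithinAt)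
    (ContinuousAt.stronglyMeasurableAtFilter isOpen_Ioo hcont x ⟨by linarith, hx1⟩)
    (hcont x ⟨by linarith, hx1⟩)).const_mul (kappa ℓ)
  refine hd.congr_of_eventuallyEq ?_
  filter_upwards [lt_mem_nhds hx] with t ht
  simp only [gOpt, if_neg (not_le.2 ht)]

theorem hasDerivAt_gOpt_of_lt {ℓ x : ℝ} (hx0 : 0 < x) (hx : x < 1 / 2) :
    HasDerivAt (gOpt ℓ)
      (kappa ℓ * (x ^ (ℓ - 8) * (1 - x) ^ (2 * ℓ + 4)) ^ (1 / (ℓ + 4))) x := by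
  have hcont : ∀ t ∈ Ioo (0 : ℝ) 1, ContinuousAt
      (fun t : ℝ => (t ^ (ℓ - 8) * (1 - t) ^ (2 * ℓ + 4)) ^ (1 / (ℓ + 4))) t := fun t ht => by
    have h0 : t ≠ 0 := ht.1.ne'
    have h1 : 1 - t ≠ 0 := (sub_pos.2 ht.2).ne'
    have h2 : t ^ (ℓ - 8) * (1 - t) ^ (2 * ℓ + 4) ≠ 0 :=
      (mul_pos (Real.rpow_pos_of_pos ht.1 _) (Real.rpow_pos_of_pos (sub_pos.2 ht.2) _)).ne'
    exact ((continuousAt_id.rpow_const (Or.inl h0)).mul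
      ((continuousAt_const.sub continuousAt_id).rpow_const (Or.inl h1))).rpow_const (Or.inl h2)
  have hd := (intervalIntegral.integral_hasDerivAt_right (a := 1 / 2) (b := x)
    (ContinuousOn.intervalIntegrable fun t ht => by
      rw [uIcc_of_ge hx.le] at ht
      exact (hcont t ⟨by linarith [ht.1], by linarith [ht.2]⟩).continuousWithinAt)
    (ContinuousAt.stronglyMeasurableAtFilter isOpen_Ioo hcont x ⟨hx0, by linarith⟩)
    (hcont x ⟨hx0, by linarith⟩)).const_mul (kappa ℓ)
  refine hd.congr_of_eventuallyEq ?_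
  filter_upwards [gt_mem_nhds hx] with t ht
  simp only [gOpt, if_pos ht.le]

theorem deriv_gOpt_add_of_gt {ℓ x : ℝ} (hℓ : 0 ≤ ℓ) (hx : 1 / 2 < x) (hx1 : x < 1) :
    deriv (gOpt ℓ) x + deriv (gOpt ℓ) (1 - x) = optDensity ℓ x := by
  have h0 : 0 < x := by linarith
  have h1 : 0 < 1 - x := by linarith
  have h4 : ℓ + 4 ≠ 0 := by positivity
  rw [(hasDerivAt_gOpt_of_gt hx hx1).deriv, (hasDerivAt_gOpt_of_lt h1 (by linarith)).deriv,
    sub_sub_cancel, optDensity, max_eq_left (by linarith), min_eq_right (by linarith),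
    Real.mul_rpow (by positivity) (by positivity), Real.mul_rpow (by positivity) (by positivity),
    ← Real.rpow_mul h0.le, ← Real.rpow_mul h0.le, ← Real.rpow_mul h1.le, ← Real.rpow_mul h1.le,
    show (2 * ℓ - 4) * (1 / (ℓ + 4)) = (ℓ - 8) / (ℓ + 4) + 1 by field_simp; ring,
    show (2 * ℓ + 4) * (1 / (ℓ + 4)) = ℓ / (ℓ + 4) + 1 by field_simp; ring,
    Real.rpow_add_one h1.ne', Real.rpow_add_one h0.ne', mul_one_div, mul_one_div]
  ring

theorem deriv_gOpt_add {ℓ x : ℝ} (hℓ : 0 ≤ ℓ) (hx : x ∈ Ioo (0 : ℝ) 1) (hne : x ≠ 1 / 2) :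
    deriv (gOpt ℓ) x + deriv (gOpt ℓ) (1 - x) = optDensity ℓ x := by
  rcases lt_or_gt_of_ne hne with h | h
  · have := deriv_gOpt_add_of_gt hℓ (x := 1 - x) (by linarith) (by linarith [hx.1])
    rw [sub_sub_cancel, optDensity_one_sub] at this
    rw [← this, add_comm]
  · exact deriv_gOpt_add_of_gt hℓ h hx.2

theorem sq_mul_optDensity {ℓ x : ℝ} (hℓ : 0 ≤ ℓ) (hx : 1 / 2 ≤ x) (hx1 : x < 1) :
    (1 - x) ^ 2 * optDensity ℓ x = kappa ℓ * (x * (1 - x) ^ (3 : ℕ)) ^ (ℓ / (ℓ + 4)) := by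
  have h0 : 0 < x := by linarith
  have h1 : 0 < 1 - x := by linarith
  have h4 : ℓ + 4 ≠ 0 := by positivity
  have h2 : (1 - x) ^ 2 * (1 - x) ^ ((ℓ - 8) / (ℓ + 4)) =
      ((1 - x) ^ (3 : ℕ)) ^ (ℓ / (ℓ + 4)) := by
    rw [← Real.rpow_natCast _ 3, ← Real.rpow_natCast _ 2, ← Real.rpow_mul h1.le,
      ← Real.rpow_add h1]
    congr 1
    push_cast
    field_simp
    ring
  rw [optDensity, max_eq_left (by linarith), min_eq_right (by linarith),
    Real.mul_rpow h0.le (by positivity), ← h2]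
  ring

/-- A nonnegative continuous function on the real line lying below `optDensity ℓ` on `(0, 1)`. -/
noncomputable def truncDensity (ℓ δ x : ℝ) : ℝ :=
  kappa ℓ * max x (1 - x) ^ (ℓ / (ℓ + 4)) * min x (1 - x) ^ max ((ℓ - 8) / (ℓ + 4)) 0 /
    max (min x (1 - x) ^ max (-((ℓ - 8) / (ℓ + 4))) 0) δ

theorem continuous_truncDensity {ℓ δ : ℝ} (hℓ : 0 ≤ ℓ) (hδ : 0 < δ) :
    Continuous (truncDensity ℓ δ) := by
  have hmin : Continuous fun x : ℝ => min x (1 - x) := by fun_prop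
  have hmax : Continuous fun x : ℝ => max x (1 - x) := by fun_prop
  refine Continuous.div ((continuous_const.mul
    (hmax.rpow_const fun _ => Or.inr (by positivity))).mul
      (hmin.rpow_const fun _ => Or.inr (le_max_right _ _)))
    ((hmin.rpow_const fun _ => Or.inr (le_max_right _ _)).max continuous_const)
    fun x => (lt_max_of_lt_right hδ).ne'

theorem truncDensity_one_sub (ℓ δ x : ℝ) : truncDensity ℓ δ (1 - x) = truncDensity ℓ δ x := by
  simp only [truncDensity, sub_sub_cancel, max_comm (1 - x), min_comm (1 - x)]

theorem optDensity_eq_div {ℓ x : ℝ} (hx : x ∈ Ioo (0 : ℝ) 1) :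
    optDensity ℓ x =
      kappa ℓ * max x (1 - x) ^ (ℓ / (ℓ + 4)) * min x (1 - x) ^ max ((ℓ - 8) / (ℓ + 4)) 0 /
        min x (1 - x) ^ max (-((ℓ - 8) / (ℓ + 4))) 0 := by
  rw [mul_div_assoc, ← Real.rpow_sub (lt_min hx.1 (sub_pos.2 hx.2)), optDensity]
  congr 2
  rcases le_total ((ℓ - 8) / (ℓ + 4)) 0 with h | h
  · rw [max_eq_right h, max_eq_left (neg_nonneg.2 h), zero_sub, neg_neg]
  · rw [max_eq_left h, max_eq_right (neg_nonpos.2 h), sub_zero]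

theorem truncDensity_pos {ℓ δ x : ℝ} (hℓ : 0 ≤ ℓ) (hx : x ∈ Ioo (0 : ℝ) 1) :
    0 < truncDensity ℓ δ x := by
  have := kappa_pos hℓ
  have hmax : 0 < max x (1 - x) := lt_max_of_lt_left hx.1
  have hmin : 0 < min x (1 - x) := lt_min hx.1 (sub_pos.2 hx.2)
  unfold truncDensity
  positivity

theorem truncDensity_le {ℓ δ x : ℝ} (hℓ : 0 ≤ ℓ) (hx : x ∈ Ioo (0 : ℝ) 1) :
    truncDensity ℓ δ x ≤ optDensity ℓ x := by
  have := kappa_pos hℓ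
  have hmax : 0 < max x (1 - x) := lt_max_of_lt_left hx.1
  have hmin : 0 < min x (1 - x) := lt_min hx.1 (sub_pos.2 hx.2)
  rw [optDensity_eq_div hx, truncDensity]
  gcongr
  exact le_max_left _ _

theorem truncDensity_eq_or_le {ℓ δ x : ℝ} (hℓ : 0 ≤ ℓ) (hδ : 0 < δ) (hδ1 : δ < 1)
    (hx : x ∈ Ioo (0 : ℝ) 1) :
    truncDensity ℓ δ x = optDensity ℓ x ∨ kappa ℓ / 2 / δ ≤ truncDensity ℓ δ x := by
  have hκ := kappa_pos hℓ
  have hmax : 1 / 2 ≤ max x (1 - x) := by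
    rcases le_total x (1 / 2) with h | h
    · exact le_max_of_le_right (by linarith)
    · exact le_max_of_le_left h
  have hmax1 : max x (1 - x) ≤ 1 := max_le hx.2.le (by linarith [hx.1])
  rcases le_total δ (min x (1 - x) ^ max (-((ℓ - 8) / (ℓ + 4))) 0) with h | h
  · left
    rw [truncDensity, max_eq_left h, ← optDensity_eq_div hx]
  · right
    have hneg : (ℓ - 8) / (ℓ + 4) ≤ 0 := by
      by_contra! hb
      rw [max_eq_right (neg_nonpos.2 hb.le), Real.rpow_zero] at h
      linarith
    rw [truncDensity, max_eq_right h, max_eq_right hneg, Real.rpow_zero, mul_one,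
      div_eq_mul_one_div (kappa ℓ)]
    gcongr
    refine hmax.trans ?_
    conv_lhs => rw [← Real.rpow_one (max x (1 - x))]
    refine Real.rpow_le_rpow_of_exponent_ge (by linarith) hmax1 ?_
    rw [div_le_one (by linarith)]
    linarith

theorem exists_symmetric_polynomial_near_truncDensity {ℓ δ : ℝ} (hℓ : 0 ≤ ℓ) (hδ : 0 < δ) :
    ∃ p : Polynomial ℝ, (∀ x, p.eval (1 - x) = p.eval x) ∧ ∀ x ∈ Icc (0 : ℝ) 1,
      truncDensity ℓ δ x + δ ≤ p.eval x ∧ p.eval x ≤ truncDensity ℓ δ x + 2 * δ := by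
  obtain ⟨q, hq⟩ := exists_polynomial_near_of_continuousOn 0 1
    (fun x => truncDensity ℓ δ x + 3 / 2 * δ)
    ((continuous_truncDensity hℓ hδ).add continuous_const).continuousOn (δ / 2) (by positivity)
  refine ⟨Polynomial.C (1 / 2) * (q + q.comp (1 - Polynomial.X)), fun x => ?_, fun x hx => ?_⟩
  · simp only [Polynomial.eval_mul, Polynomial.eval_add, Polynomial.eval_comp, Polynomial.eval_sub,
      Polynomial.eval_one, Polynomial.eval_X, Polynomial.eval_C, sub_sub_cancel, add_comm]
  · have h1 := abs_lt.1 (hq x hx)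
    have h2 := abs_lt.1 (hq (1 - x) ⟨by linarith [hx.2], by linarith [hx.1]⟩)
    rw [truncDensity_one_sub] at h2
    simp only [Polynomial.eval_mul, Polynomial.eval_add, Polynomial.eval_comp, Polynomial.eval_sub,
      Polynomial.eval_one, Polynomial.eval_X, Polynomial.eval_C]
    constructor <;> linarith [h1.1, h1.2, h2.1, h2.2]

theorem integral_sq_mul_le {ℓ δ : ℝ} (hℓ : 0 ≤ ℓ) (hδ : 0 ≤ δ) {p : Polynomial ℝ}
    (hp : ∀ x ∈ Ioo (0 : ℝ) 1, p.eval x ≤ optDensity ℓ x + 2 * δ) :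
    ∫ x in (1 / 2 : ℝ)..1, (1 - x) ^ 2 * p.eval x ≤ 1 + 2 * δ := by
  have hint : ∫ x in (1 / 2 : ℝ)..1,
      (kappa ℓ * (x * (1 - x) ^ (3 : ℕ)) ^ (ℓ / (ℓ + 4)) + 2 * δ) = 1 + 2 * δ * (1 - 1 / 2) := by
    rw [intervalIntegral.integral_add
      (((continuous_kappa_integrand hℓ).const_mul _).intervalIntegrable _ _)
      intervalIntegrable_const, intervalIntegral.integral_const_mul, kappa_eq,
      inv_mul_cancel₀ (kappa_integral_pos hℓ).ne', intervalIntegral.integral_const, smul_eq_mul]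
    ring
  have hle : ∫ x in (1 / 2 : ℝ)..1, (1 - x) ^ 2 * p.eval x ≤ ∫ x in (1 / 2 : ℝ)..1,
      (kappa ℓ * (x * (1 - x) ^ (3 : ℕ)) ^ (ℓ / (ℓ + 4)) + 2 * δ) := by
    refine intervalIntegral.integral_mono_on_of_le_Ioo (by norm_num)
      (Continuous.intervalIntegrable (by fun_prop) _ _)
      ((((continuous_kappa_integrand hℓ).const_mul _).add
        continuous_const).intervalIntegrable _ _) fun x hx => ?_
    have hx0 : 0 < x := by linarith [hx.1]
    rw [← sq_mul_optDensity hℓ hx.1.le hx.2]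
    have h1 : (1 - x) ^ 2 ≤ 1 := by nlinarith [hx.2]
    nlinarith [mul_le_mul_of_nonneg_left (hp x ⟨hx0, hx.2⟩) (sq_nonneg (1 - x)),
      mul_le_mul_of_nonneg_right h1 hδ]
  rw [hint] at hle
  linarith

theorem exists_polynomial_rule_Ind_le {ℓ δ : ℝ} (hℓ : 0 ≤ ℓ) (hδ : 0 < δ) (hδ1 : δ < 1) :
    ∃ P : Polynomial ℝ, IsProperRule (fun x => P.eval x) ∧ IsNormalizedRule (fun x => P.eval x) ∧
      (∃ a > (0 : ℝ), ∀ x ∈ Ioo (0 : ℝ) 1,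
        a ≤ deriv (fun x => P.eval x) x + deriv (fun x => P.eval x) (1 - x)) ∧
      Ind ℓ (fun x => P.eval x) ≤ ENNReal.ofReal (1 + 2 * δ) ^ (ℓ / 4) *
        (Ind ℓ (gOpt ℓ) + ENNReal.ofReal (2 * δ / kappa ℓ) ^ (ℓ / 4)) := by
  have hκ := kappa_pos hℓ
  obtain ⟨p, hsymm, hp⟩ := exists_symmetric_polynomial_near_truncDensity hℓ hδ
  set N := ∫ x in (1 / 2 : ℝ)..1, (1 - x) ^ 2 * p.eval x with hN
  have hpt : ∀ x ∈ Ioo (0 : ℝ) 1, truncDensity ℓ δ x + δ ≤ p.eval x :=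
    fun x hx => (hp x (Ioo_subset_Icc_self hx)).1
  have hpδ : ∀ x ∈ Ioo (0 : ℝ) 1, δ ≤ p.eval x :=
    fun x hx => by linarith [hpt x hx, truncDensity_pos (δ := δ) hℓ hx]
  have hN0 : 0 < N := by
    refine intervalIntegral.intervalIntegral_pos_of_pos_on
      (Continuous.intervalIntegrable (by fun_prop) _ _) (fun x hx => ?_) (by norm_num)
    have hx0 : 0 < x := by linarith [hx.1]
    exact mul_pos (pow_pos (sub_pos.2 hx.2) 2) (hδ.trans_le (hpδ x ⟨hx0, hx.2⟩))
  have hN1 : N ≤ 1 + 2 * δ := integral_sq_mul_le hℓ hδ.le fun x hx => by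
    linarith [(hp x (Ioo_subset_Icc_self hx)).2, truncDensity_le (δ := δ) hℓ hx]
  set w : Polynomial ℝ := Polynomial.C N⁻¹ * p with hw
  have hwe : ∀ x, w.eval x = p.eval x / N := fun x => by
    rw [hw, Polynomial.eval_mul, Polynomial.eval_C, div_eq_inv_mul]
  have hws : ∀ x, w.eval (1 - x) = w.eval x := fun x => by rw [hwe, hwe, hsymm]
  have hwpos : ∀ x ∈ Ioo (0 : ℝ) 1, δ / N ≤ w.eval x := fun x hx => by
    rw [hwe]
    exact div_le_div_of_nonneg_right (hpδ x hx) hN0.le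
  obtain ⟨P, hP0, hP⟩ := exists_rule_of_density w
  refine ⟨P, isProperRule_of_density hws hP fun x hx => (div_pos hδ hN0).trans_le (hwpos x hx),
    ⟨hP0, ?_⟩, ⟨δ / N, div_pos hδ hN0, fun x hx => ?_⟩, ?_⟩
  · rw [integral_rewardFn_rule hws hP hP0]
    simp only [hwe, ← mul_div_assoc]
    rw [intervalIntegral.integral_div, ← hN, div_self hN0.ne']
  · rw [deriv_rule_add hws hP]
    exact hwpos x hx
  have hℓ4 : 0 ≤ ℓ / 4 := by positivity
  have hpoint : ∀ x ∈ Ioo (0 : ℝ) 1, x ≠ 1 / 2 →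
      (ENNReal.ofReal (x * (1 - x)) /
        ENNReal.ofReal (deriv (fun x => P.eval x) x + deriv (fun x => P.eval x) (1 - x))) ^
          (ℓ / 4) ≤
      ENNReal.ofReal (1 + 2 * δ) ^ (ℓ / 4) * ((ENNReal.ofReal (x * (1 - x)) /
        ENNReal.ofReal (deriv (gOpt ℓ) x + deriv (gOpt ℓ) (1 - x))) ^ (ℓ / 4) +
          ENNReal.ofReal (2 * δ / kappa ℓ) ^ (ℓ / 4)) := by
    intro x hx hne
    have hx1 : 0 < 1 - x := sub_pos.2 hx.2
    have hxx : 0 < x * (1 - x) := mul_pos hx.1 hx1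
    have hopt := optDensity_pos hℓ hx
    have htr := truncDensity_pos (δ := δ) hℓ hx
    have hwx := (div_pos hδ hN0).trans_le (hwpos x hx)
    rw [deriv_rule_add hws hP, deriv_gOpt_add hℓ hx hne, ← ENNReal.ofReal_div_of_pos hwx,
      ← ENNReal.ofReal_div_of_pos hopt]
    have hbase : x * (1 - x) / w.eval x ≤ (1 + 2 * δ) * (x * (1 - x) / truncDensity ℓ δ x) := by
      rw [hwe, div_div_eq_mul_div, mul_comm, mul_div_assoc]
      have hle := hpt x hx
      have hpx : 0 < p.eval x := hδ.trans_le (hpδ x hx)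
      gcongr
      linarith
    have key : ∀ s, x * (1 - x) / truncDensity ℓ δ x ≤ s →
        ENNReal.ofReal (x * (1 - x) / w.eval x) ^ (ℓ / 4) ≤
          ENNReal.ofReal (1 + 2 * δ) ^ (ℓ / 4) * ENNReal.ofReal s ^ (ℓ / 4) := fun s hs => by
      rw [← ENNReal.mul_rpow_of_nonneg _ _ hℓ4, ← ENNReal.ofReal_mul (by positivity)]
      refine ENNReal.rpow_le_rpow (ENNReal.ofReal_le_ofReal (hbase.trans ?_)) hℓ4
      gcongr
    rcases truncDensity_eq_or_le hℓ hδ hδ1 hx with h | h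
    · refine (key _ (by rw [h])).trans ?_
      gcongr
      exact le_self_add
    · refine (key (2 * δ / kappa ℓ) ?_).trans ?_
      · calc x * (1 - x) / truncDensity ℓ δ x ≤ 1 / (kappa ℓ / 2 / δ) := by
              gcongr
              nlinarith [hx.1]
          _ = 2 * δ / kappa ℓ := by field_simp
      · gcongr
        exact le_add_self
  have hae : ∀ᵐ x ∂volume.restrict (Ioo (0 : ℝ) 1), x ∈ Ioo (0 : ℝ) 1 ∧ x ≠ 1 / 2 :=
    (ae_restrict_mem measurableSet_Ioo).and (ae_restrict_of_ae (Measure.ae_ne volume (1 / 2)))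
  have hfin : ENNReal.ofReal (1 + 2 * δ) ^ (ℓ / 4) ≠ ∞ :=
    ENNReal.rpow_ne_top_of_nonneg hℓ4 ENNReal.ofReal_ne_top
  refine (lintegral_mono_ae (hae.mono fun x hx => hpoint x hx.1 hx.2)).trans ?_
  rw [lintegral_const_mul' _ _ hfin, lintegral_add_right _ measurable_const, lintegral_const]
  simp [Ind]

theorem polynomial_near_optimal (ℓ : ℝ) (hℓ : 1 ≤ ℓ) (ε : ℝ) (hε : 0 < ε) :
    ∃ f : ℝ → ℝ, (∃ P : Polynomial ℝ, ∀ x, f x = P.eval x) ∧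
      IsProperRule f ∧ IsNormalizedRule f ∧
      (∃ a > (0:ℝ), ∀ x ∈ Set.Ioo (0:ℝ) 1, a ≤ deriv f x + deriv f (1 - x)) ∧
      Ind ℓ f ≤ Ind ℓ (gOpt ℓ) + ENNReal.ofReal ε := by
  have hℓ0 : 0 ≤ ℓ := zero_le_one.trans hℓ
  rcases eq_or_ne (Ind ℓ (gOpt ℓ)) ∞ with htop | htop
  · obtain ⟨P, h1, h2, h3, -⟩ :=
      exists_polynomial_rule_Ind_le hℓ0 (δ := 1 / 2) (by norm_num) (by norm_num)
    exact ⟨fun x => P.eval x, ⟨P, fun _ => rfl⟩, h1, h2, h3, by simp [htop]⟩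
  set I := (Ind ℓ (gOpt ℓ)).toReal with hI
  have hℓ4 : 0 ≤ ℓ / 4 := by positivity
  have hcont : Continuous fun δ : ℝ =>
      (1 + 2 * δ) ^ (ℓ / 4) * (I + (2 * δ / kappa ℓ) ^ (ℓ / 4)) :=
    (Continuous.rpow_const (by fun_prop) fun _ => Or.inr hℓ4).mul
      (continuous_const.add (Continuous.rpow_const (by fun_prop) fun _ => Or.inr hℓ4))
  have hlim := hcont.tendsto 0
  simp only [mul_zero, add_zero, Real.one_rpow, zero_div, one_mul,
    Real.zero_rpow (show ℓ / 4 ≠ 0 by positivity)] at hlim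
  obtain ⟨δ, hδI, hδ⟩ := (((hlim.mono_left nhdsWithin_le_nhds).eventually
    (gt_mem_nhds (show I < I + ε by linarith))).and
      (Ioo_mem_nhdsGT (zero_lt_one' ℝ))).exists
  have hδ0 := hδ.1
  have hκ := kappa_pos hℓ0
  obtain ⟨P, h1, h2, h3, h4⟩ := exists_polynomial_rule_Ind_le hℓ0 hδ.1 hδ.2
  refine ⟨fun x => P.eval x, ⟨P, fun _ => rfl⟩, h1, h2, h3, h4.trans ?_⟩
  have hI0 : 0 ≤ I := ENNReal.toReal_nonneg
  rw [← ENNReal.ofReal_toReal htop, ← hI, ENNReal.ofReal_rpow_of_nonneg (by positivity) hℓ4,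
    ENNReal.ofReal_rpow_of_nonneg (by positivity) hℓ4, ← ENNReal.ofReal_add hI0 (by positivity),
    ← ENNReal.ofReal_mul (by positivity), ← ENNReal.ofReal_add hI0 hε.le]
  exact ENNReal.ofReal_le_ofReal hδI.le
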